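/- Fix α ∈ (0, π). The function ℓ^α : (0,π) → ℝ defined by ℓ^α(x) = (1/(4π²)) ∫_{[0,2π]²} √(1 + g_x^α(s,u)²) ds du is continuous on (0, π), where g_x^α(s,u) = sin(x)·sin((s−α)/2)·sin((s+α)/2) / ( sin²((u−x)/2)·sin²((s+α)/2) + sin²((u+x)/2)·sin²((s−α)/2) ). -/

import Mathlib

open Real MeasureTheory

noncomputable def gfun (α x s u : ℝ) : ℝ :=
  Real.sin x * Real.sin ((s - α) / 2) * Real.sin ((s + α) / 2) /
    (Real.sin ((u - x) / 2) ^ 2 * Real.sin ((s + α) / 2) ^ 2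
      + Real.sin ((u + x) / 2) ^ 2 * Real.sin ((s - α) / 2) ^ 2)

noncomputable def ellAlpha (α x : ℝ) : ℝ :=
  (1 / (4 * π ^ 2)) *
    ∫ p in Set.Icc (0 : ℝ) (2 * π) ×ˢ Set.Icc (0 : ℝ) (2 * π),
      Real.sqrt (1 + gfun α x p.1 p.2 ^ 2)

/-- The function `t ↦ |sin ((t + y) / 2)|^(-1/2)`. -/
noncomputable def invSqrtSin (y t : ℝ) : ℝ := (√|sin ((t + y) / 2)|)⁻¹

lemma invSqrtSin_nonneg (y t : ℝ) : 0 ≤ invSqrtSin y t := by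
  unfold invSqrtSin; positivity

lemma measurable_invSqrtSin (y : ℝ) : Measurable (invSqrtSin y) := by
  unfold invSqrtSin; fun_prop

lemma periodic_invSqrtSin : Function.Periodic (invSqrtSin 0) (2 * π) := by
  intro t
  have h : (t + 2 * π + 0) / 2 = (t + 0) / 2 + π := by ring
  simp only [invSqrtSin]
  rw [h, sin_add_pi, abs_neg]

lemma intervalIntegrable_invSqrtSin_zero (a b : ℝ) :
    IntervalIntegrable (invSqrtSin 0) volume a b := by
  have h1 : IntervalIntegrable (invSqrtSin 0) volume 0 π := by
    have h := (intervalIntegral.intervalIntegrable_rpow' (a := 0) (b := π)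
      (r := -(1 / 2)) (by norm_num)).const_mul (√π)
    refine h.mono_fun' (measurable_invSqrtSin 0).aestronglyMeasurable ?_
    refine (ae_restrict_iff' measurableSet_uIoc).2 (ae_of_all _ fun t ht => ?_)
    rw [Set.uIoc_of_le pi_pos.le] at ht
    have ht0 : 0 < t := ht.1
    have hs : t / π ≤ |sin ((t + 0) / 2)| := by
      have := mul_le_sin (x := t / 2) (by linarith) (by linarith [ht.2])
      rw [add_zero]
      refine le_trans (le_of_eq ?_) (this.trans (le_abs_self _))
      field_simp
    beta_reduce
    rw [Real.norm_of_nonneg (invSqrtSin_nonneg _ _), rpow_neg ht0.le, ← sqrt_eq_rpow]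
    unfold invSqrtSin
    calc (√|sin ((t + 0) / 2)|)⁻¹ ≤ (√(t / π))⁻¹ := by
          have : 0 < √(t / π) := sqrt_pos.2 (div_pos ht0 pi_pos)
          gcongr
      _ = √π * (√t)⁻¹ := by rw [sqrt_div ht0.le, inv_div, div_eq_mul_inv]
  have h2 : IntervalIntegrable (invSqrtSin 0) volume (-π) 0 := by
    have h := (IntervalIntegrable.iff_comp_neg (by simp)).1 h1
    rw [neg_zero] at h
    refine h.symm.congr fun t _ => ?_
    simp [invSqrtSin, neg_div]
  refine periodic_invSqrtSin.intervalIntegrable (t := -π) (by positivity) ?_ a b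
  have : -π + 2 * π = π := by ring
  rw [this]
  exact h2.trans h1

lemma invSqrtSin_eq (y : ℝ) : invSqrtSin y = fun t => invSqrtSin 0 (t + y) := by
  ext t; simp [invSqrtSin]

lemma integrable_invSqrtSin (y : ℝ) :
    Integrable (invSqrtSin y) (volume.restrict (Set.Icc 0 (2 * π))) := by
  have h := (intervalIntegrable_invSqrtSin_zero (0 + y) (2 * π + y)).comp_add_right y
  simp only [add_sub_cancel_right] at h
  rw [← invSqrtSin_eq] at h
  exact (intervalIntegrable_iff_integrableOn_Icc_of_le (by positivity)).1 h

lemma integral_invSqrtSin (y : ℝ) :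
    ∫ t in Set.Icc 0 (2 * π), invSqrtSin y t = ∫ t in Set.Icc 0 (2 * π), invSqrtSin 0 t := by
  have h0 : (0 : ℝ) ≤ 2 * π := by positivity
  rw [integral_Icc_eq_integral_Ioc, integral_Icc_eq_integral_Ioc,
    ← intervalIntegral.integral_of_le h0, ← intervalIntegral.integral_of_le h0, invSqrtSin_eq,
    intervalIntegral.integral_comp_add_right (invSqrtSin 0)]
  have := periodic_invSqrtSin.intervalIntegral_add_eq (0 + y) 0
  rw [← zero_add (2 * π), ← this]
  congr 1
  ring

lemma ae_sin_half_ne_zero (y : ℝ) : ∀ᵐ t : ℝ, sin ((t + y) / 2) ≠ 0 := by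
  have hc : (Set.range fun n : ℤ => 2 * (n * π) - y).Countable := Set.countable_range _
  filter_upwards [hc.ae_notMem volume] with t ht h
  obtain ⟨n, hn⟩ := sin_eq_zero_iff.1 h
  exact ht ⟨n, by simp only; linarith⟩

lemma sin_le_abs_add_abs (x u : ℝ) : sin x ≤ |sin ((u - x) / 2)| + |sin ((u + x) / 2)| := by
  have h : sin x =
      sin ((u + x) / 2) * cos ((u - x) / 2) - cos ((u + x) / 2) * sin ((u - x) / 2) := by
    rw [← sin_sub]; congr 1; ring
  have h1 : sin ((u + x) / 2) * cos ((u - x) / 2) ≤ |sin ((u + x) / 2)| := by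
    refine (le_abs_self _).trans ?_
    rw [abs_mul]
    exact mul_le_of_le_one_right (abs_nonneg _) (abs_cos_le_one _)
  have h2 : -(cos ((u + x) / 2) * sin ((u - x) / 2)) ≤ |sin ((u - x) / 2)| := by
    refine (neg_le_abs _).trans ?_
    rw [abs_mul]
    exact mul_le_of_le_one_left (abs_nonneg _) (abs_cos_le_one _)
  linarith

lemma quartic_div_le {A B C D δ : ℝ} (hA : 0 < A) (hB : 0 < B) (hC : 0 < C) (hδ : 0 < δ)
    (hB1 : B ≤ 1) (hD : δ ≤ D) :
    A ^ 2 * B ^ 2 / (C ^ 4 * B ^ 4 + D ^ 4 * A ^ 4) ≤ (δ ^ 3)⁻¹ * (A⁻¹ * C⁻¹) := by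
  have hD0 : 0 < D := hδ.trans_le hD
  have key : ∀ x y : ℝ, 0 < x → 0 < y → x * y ^ 3 ≤ x ^ 4 + y ^ 4 := by
    intro x y hx hy
    rcases le_total x y with h | h
    · have : x * y ^ 3 ≤ y * y ^ 3 := by gcongr
      nlinarith [pow_pos hx 4]
    · have : x * y ^ 3 ≤ x * x ^ 3 := by gcongr
      nlinarith [pow_pos hy 4]
  have h1 := key (C * B) (D * A) (by positivity) (by positivity)
  have h2 : C * B * (δ * A) ^ 3 ≤ C * B * (D * A) ^ 3 := by gcongr
  rw [← mul_inv, ← mul_inv, ← one_div, div_le_div_iff₀ (by positivity) (by positivity)]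
  calc A ^ 2 * B ^ 2 * (δ ^ 3 * (A * C)) = (C * B * (δ * A) ^ 3) * B := by ring
    _ ≤ (C * B * (δ * A) ^ 3) * 1 := by gcongr
    _ ≤ 1 * (C ^ 4 * B ^ 4 + D ^ 4 * A ^ 4) := by linarith

lemma abs_gfun_le {m α x s u : ℝ} (hm : 0 < m) (hx : m ≤ sin x)
    (ha : sin ((s + -α) / 2) ≠ 0) (hb : sin ((s + α) / 2) ≠ 0)
    (hc : sin ((u + -x) / 2) ≠ 0) (hd : sin ((u + x) / 2) ≠ 0) :
    |gfun α x s u| ≤ (√(m / 2) ^ 3)⁻¹ *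
      (invSqrtSin (-α) s * invSqrtSin (-x) u + invSqrtSin α s * invSqrtSin x u) := by
  have hcd := sin_le_abs_add_abs x u
  have hsx0 : 0 ≤ sin x := hm.le.trans hx
  have hsx1 := sin_le_one x
  have ha1 := abs_sin_le_one ((s + -α) / 2)
  have hb1 := abs_sin_le_one ((s + α) / 2)
  simp only [gfun, invSqrtSin, sub_eq_add_neg] at *
  generalize sin ((s + -α) / 2) = a at *
  generalize sin ((s + α) / 2) = b at *
  generalize sin ((u + -x) / 2) = c at *
  generalize sin ((u + x) / 2) = d at *
  have hA := sqrt_pos.2 (abs_pos.2 ha)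
  have hB := sqrt_pos.2 (abs_pos.2 hb)
  have hC := sqrt_pos.2 (abs_pos.2 hc)
  have hD := sqrt_pos.2 (abs_pos.2 hd)
  have hA1 : √|a| ≤ 1 := sqrt_le_one.2 ha1
  have hB1 : √|b| ≤ 1 := sqrt_le_one.2 hb1
  have hδ : 0 < √(m / 2) := sqrt_pos.2 (by linarith)
  have h4 : ∀ z : ℝ, √|z| ^ 4 = z ^ 2 := fun z => by
    rw [show √|z| ^ 4 = (√|z| ^ 2) ^ 2 by ring, sq_sqrt (abs_nonneg z), sq_abs]
  have h2 : ∀ z : ℝ, √|z| ^ 2 = |z| := fun z => sq_sqrt (abs_nonneg z)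
  have hle : |sin x * a * b / (c ^ 2 * b ^ 2 + d ^ 2 * a ^ 2)|
      ≤ √|a| ^ 2 * √|b| ^ 2 / (√|c| ^ 4 * √|b| ^ 4 + √|d| ^ 4 * √|a| ^ 4) := by
    simp only [h4, h2]
    have hden : 0 ≤ c ^ 2 * b ^ 2 + d ^ 2 * a ^ 2 := by positivity
    rw [abs_div, abs_of_nonneg hden, abs_mul, abs_mul, abs_of_nonneg hsx0]
    gcongr
    exact mul_le_of_le_one_left (abs_nonneg _) hsx1
  refine hle.trans ?_
  rw [mul_add]
  rcases le_total (m / 2) |d| with h | h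
  · refine (quartic_div_le hA hB hC hδ hB1 (sqrt_le_sqrt h)).trans ?_
    exact le_add_of_nonneg_right (by positivity)
  · have h' : m / 2 ≤ |c| := by linarith
    rw [mul_comm (√|a| ^ 2), add_comm (√|c| ^ 4 * √|b| ^ 4)]
    refine (quartic_div_le hB hA hD hδ hA1 (sqrt_le_sqrt h')).trans ?_
    exact le_add_of_nonneg_left (by positivity)

lemma gfun_denominator_ge {m α x s u : ℝ} (hm : 0 < m) (hx : m ≤ sin x) :
    sin ((s - α) / 2) ^ 2 * sin ((s + α) / 2) ^ 2 * (m ^ 2 / 2) ≤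
      sin ((u - x) / 2) ^ 2 * sin ((s + α) / 2) ^ 2
        + sin ((u + x) / 2) ^ 2 * sin ((s - α) / 2) ^ 2 := by
  have hcd := hx.trans (sin_le_abs_add_abs x u)
  have ha := sin_sq_le_one ((s - α) / 2)
  have hb := sin_sq_le_one ((s + α) / 2)
  generalize sin ((s - α) / 2) = a at *
  generalize sin ((s + α) / 2) = b at *
  generalize sin ((u - x) / 2) = c at *
  generalize sin ((u + x) / 2) = d at *
  have h : m ^ 2 / 2 ≤ c ^ 2 + d ^ 2 := by
    nlinarith [sq_abs c, sq_abs d, sq_nonneg (|c| - |d|), abs_nonneg c, abs_nonneg d]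
  calc a ^ 2 * b ^ 2 * (m ^ 2 / 2) ≤ a ^ 2 * b ^ 2 * (c ^ 2 + d ^ 2) := by gcongr
    _ = a ^ 2 * (c ^ 2 * b ^ 2) + b ^ 2 * (d ^ 2 * a ^ 2) := by ring
    _ ≤ 1 * (c ^ 2 * b ^ 2) + 1 * (d ^ 2 * a ^ 2) := by gcongr
    _ = _ := by ring

lemma abs_gfun_le_of_fixed {m α x s u : ℝ} (hm : 0 < m) (hx : m ≤ sin x)
    (ha : sin ((s - α) / 2) ≠ 0) (hb : sin ((s + α) / 2) ≠ 0) :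
    |gfun α x s u| ≤ (sin ((s - α) / 2) ^ 2 * sin ((s + α) / 2) ^ 2 * (m ^ 2 / 2))⁻¹ := by
  have hden := gfun_denominator_ge (α := α) (s := s) (u := u) hm hx
  have hpos : 0 < sin ((s - α) / 2) ^ 2 * sin ((s + α) / 2) ^ 2 * (m ^ 2 / 2) := by positivity
  rw [gfun, abs_div, abs_of_pos (hpos.trans_le hden), ← one_div, abs_mul, abs_mul]
  have h1 := abs_sin_le_one x
  have h2 := abs_sin_le_one ((s - α) / 2)
  have h3 := abs_sin_le_one ((s + α) / 2)
  gcongr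
  exact mul_le_one₀ (mul_le_one₀ h1 (abs_nonneg _) h2) (abs_nonneg _) h3

lemma continuousAt_gfun {α x s u : ℝ} (hx : 0 < sin x)
    (ha : sin ((s - α) / 2) ≠ 0) (hb : sin ((s + α) / 2) ≠ 0) :
    ContinuousAt (fun y => gfun α y s u) x := by
  have hden := gfun_denominator_ge (α := α) (s := s) (u := u) hx le_rfl
  have hpos : 0 < sin ((s - α) / 2) ^ 2 * sin ((s + α) / 2) ^ 2 * (sin x ^ 2 / 2) := by positivity
  unfold gfun
  exact ContinuousAt.div (by fun_prop) (by fun_prop) (hpos.trans_le hden).ne'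

lemma measurable_gfun (α x : ℝ) : Measurable fun p : ℝ × ℝ => gfun α x p.1 p.2 := by
  unfold gfun; fun_prop

lemma norm_sqrt_one_add_sq_le (g : ℝ) : ‖√(1 + g ^ 2)‖ ≤ 1 + |g| := by
  rw [Real.norm_of_nonneg (sqrt_nonneg _)]
  refine sqrt_le_iff.2 ⟨by positivity, ?_⟩
  nlinarith [sq_abs g, abs_nonneg g]

lemma norm_integrand_le {m α x s u : ℝ} (hm : 0 < m) (hx : m ≤ sin x)
    (ha : sin ((s + -α) / 2) ≠ 0) (hb : sin ((s + α) / 2) ≠ 0)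
    (hc : sin ((u + -x) / 2) ≠ 0) (hd : sin ((u + x) / 2) ≠ 0) :
    ‖√(1 + gfun α x s u ^ 2)‖ ≤ 1 + (√(m / 2) ^ 3)⁻¹ *
      (invSqrtSin (-α) s * invSqrtSin (-x) u + invSqrtSin α s * invSqrtSin x u) := by
  linarith [norm_sqrt_one_add_sq_le (gfun α x s u), abs_gfun_le hm hx ha hb hc hd]

lemma integrable_integrand {α x : ℝ} (hx : 0 < sin x) :
    Integrable (fun p : ℝ × ℝ => √(1 + gfun α x p.1 p.2 ^ 2))
      ((volume.restrict (Set.Icc 0 (2 * π))).prod (volume.restrict (Set.Icc 0 (2 * π)))) := by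
  set ν := volume.restrict (Set.Icc 0 (2 * π))
  have hν (y : ℝ) : ∀ᵐ t ∂ν, sin ((t + y) / 2) ≠ 0 := ae_restrict_of_ae (ae_sin_half_ne_zero y)
  have h1 := (integrable_invSqrtSin (-α)).mul_prod (integrable_invSqrtSin (-x))
  have h2 := (integrable_invSqrtSin α).mul_prod (integrable_invSqrtSin x)
  have hmeas := measurable_gfun α x
  refine ((integrable_const (1 : ℝ)).add ((h1.add h2).const_mul (√(sin x / 2) ^ 3)⁻¹)).mono'
    (by fun_prop : Measurable _).aestronglyMeasurable ?_
  filter_upwards [Measure.quasiMeasurePreserving_fst.ae (hν (-α)),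
    Measure.quasiMeasurePreserving_fst.ae (hν α), Measure.quasiMeasurePreserving_snd.ae (hν (-x)),
    Measure.quasiMeasurePreserving_snd.ae (hν x)] with p ha hb hc hd
  exact norm_integrand_le hx le_rfl ha hb hc hd

lemma continuousAt_inner_integral {α x s : ℝ} (hx : 0 < sin x)
    (ha : sin ((s - α) / 2) ≠ 0) (hb : sin ((s + α) / 2) ≠ 0) :
    ContinuousAt (fun y => ∫ u in Set.Icc 0 (2 * π), √(1 + gfun α y s u ^ 2)) x := by
  have hm : 0 < sin x / 2 := by linarith
  have hev : ∀ᶠ y in nhds x, sin x / 2 < sin y :=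
    continuous_sin.continuousAt.eventually_const_lt (by linarith)
  refine continuousAt_of_dominated (bound := fun _ => 1 +
    (sin ((s - α) / 2) ^ 2 * sin ((s + α) / 2) ^ 2 * ((sin x / 2) ^ 2 / 2))⁻¹)
    (Filter.Eventually.of_forall fun y => ?_) ?_ (integrable_const _) (ae_of_all _ fun u => ?_)
  · have := (measurable_gfun α y).comp (measurable_prodMk_left (x := s))
    exact ((this.pow_const 2).const_add 1).sqrt.aestronglyMeasurable
  · filter_upwards [hev] with y hy
    refine ae_of_all _ fun u => (norm_sqrt_one_add_sq_le _).trans ?_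
    gcongr
    exact abs_gfun_le_of_fixed hm hy.le ha hb
  · exact ((continuousAt_gfun hx ha hb).pow 2 |>.const_add 1).sqrt

lemma norm_inner_integral_le {m α x s : ℝ} (hm : 0 < m) (hx : m ≤ sin x)
    (ha : sin ((s + -α) / 2) ≠ 0) (hb : sin ((s + α) / 2) ≠ 0) :
    ‖∫ u in Set.Icc 0 (2 * π), √(1 + gfun α x s u ^ 2)‖ ≤
      (∫ _ in Set.Icc 0 (2 * π), (1 : ℝ)) + (√(m / 2) ^ 3)⁻¹ *
        ((invSqrtSin (-α) s + invSqrtSin α s) * ∫ u in Set.Icc 0 (2 * π), invSqrtSin 0 u) := by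
  have h1 := (integrable_invSqrtSin (-x)).const_mul (invSqrtSin (-α) s)
  have h2 := (integrable_invSqrtSin x).const_mul (invSqrtSin α s)
  have h12 := (h1.add h2).const_mul (√(m / 2) ^ 3)⁻¹
  have h := (integrable_const (1 : ℝ)).add h12
  refine (norm_integral_le_of_norm_le h ?_).trans (le_of_eq ?_)
  · filter_upwards [ae_restrict_of_ae (ae_sin_half_ne_zero (-x)),
      ae_restrict_of_ae (ae_sin_half_ne_zero x)] with u hc hd
    exact norm_integrand_le hm hx ha hb hc hd
  · rw [integral_add' (integrable_const _) h12, integral_const_mul, integral_add' h1 h2,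
      integral_const_mul, integral_const_mul, integral_invSqrtSin (-x), integral_invSqrtSin x,
      add_mul]

theorem ellAlpha_continuous (α : ℝ) (hα : α ∈ Set.Ioo 0 π) :
    ContinuousOn (ellAlpha α) (Set.Ioo 0 π) := by
  have hfubini : ∀ x ∈ Set.Ioo 0 π, ellAlpha α x = (1 / (4 * π ^ 2)) *
      ∫ s in Set.Icc 0 (2 * π), ∫ u in Set.Icc 0 (2 * π), √(1 + gfun α x s u ^ 2) := by
    intro x hx
    rw [ellAlpha, Measure.volume_eq_prod, ← Measure.prod_restrict,
      integral_prod _ (integrable_integrand (sin_pos_of_mem_Ioo hx))]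
  refine ContinuousOn.congr (continuousOn_const.mul fun x hx => ?_) hfubini
  refine ContinuousAt.continuousWithinAt ?_
  have hx0 := sin_pos_of_mem_Ioo hx
  have hev : ∀ᶠ y in nhds x, sin x / 2 < sin y :=
    continuous_sin.continuousAt.eventually_const_lt (by linarith)
  have hm : 0 < sin x / 2 := by linarith
  refine continuousAt_of_dominated (bound := fun s => (∫ _ in Set.Icc 0 (2 * π), (1 : ℝ)) +
    (√(sin x / 2 / 2) ^ 3)⁻¹ * ((invSqrtSin (-α) s + invSqrtSin α s) *
      ∫ u in Set.Icc 0 (2 * π), invSqrtSin 0 u)) ?_ ?_ ?_ ?_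
  · filter_upwards [hev] with y hy
    exact (integrable_integrand (hm.trans hy)).integral_prod_left.aestronglyMeasurable
  · filter_upwards [hev] with y hy
    filter_upwards [ae_restrict_of_ae (ae_sin_half_ne_zero (-α)),
      ae_restrict_of_ae (ae_sin_half_ne_zero α)] with s ha hb
    exact norm_inner_integral_le hm hy.le ha hb
  · exact (integrable_const _).add
      ((((integrable_invSqrtSin _).add (integrable_invSqrtSin _)).mul_const _).const_mul _)
  · filter_upwards [ae_restrict_of_ae (ae_sin_half_ne_zero (-α)),
      ae_restrict_of_ae (ae_sin_half_ne_zero α)] with s ha hb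
    exact continuousAt_inner_integral hx0 ha hb
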